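/- arXiv:2510.09399 — 2 statements merged into one kernel-verified Lean document; each statement's English description precedes it below -/
import Mathlib

section
/- Let R be a PID and (C, d) a filtered complex with spectral sequence {E^r(C), d^r}. If rank_R E^r_p(C) = rank_R E^{r+1}_p(C) for some r ≥ 0 and p, then the image of d^r_{p−r} : E^r_{p−r}(C) → E^r_p(C) is contained in the torsion submodule of E^r_p(C), and Tor H_*(E^r_p(C)) = Tor(Ker d^r_p) / Im d^r_{p−r}. In particular, if Tor E^r_p(C) is finite, then |Tor E^r_p(C)| ≥ |Tor E^{r+1}_p(C)|. -/
open LinearMap Submodule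

/-- A *filtered complex* over `R`: a chain complex `(C, d)` together with a direct
sum decomposition `C = ⊕_{i₀ ≤ i ≤ i₁} Cᵢ` (here `G i`), such that
`d(Cᵢ) ⊆ ⊕_{j ≥ i} Cⱼ`.  (The ambient `ℤ/4`-grading plays no role in the filtered
algebra and is omitted.) -/
structure FilteredCx (R : Type*) (C : Type*) [CommRing R] [AddCommGroup C]
    [Module R C] where
  d : C →ₗ[R] C
  dd : d ∘ₗ d = 0
  G : ℤ → Submodule R C
  internal : DirectSum.IsInternal fun i : ℤ => G i
  i₀ : ℤ
  i₁ : ℤ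
  hGlow : ∀ i : ℤ, i < i₀ → G i = ⊥
  hGhigh : ∀ i : ℤ, i₁ < i → G i = ⊥
  hdG : ∀ i : ℤ, (G i).map d ≤ ⨆ j : ℤ, ⨆ _ : i ≤ j, G j

namespace FilteredCx

variable {R C : Type*} [CommRing R] [AddCommGroup C] [Module R C]

/-- The filtration `F_pC = ⊕_{i ≥ p} Cᵢ`. -/
def F (X : FilteredCx R C) (p : ℤ) : Submodule R C :=
  ⨆ j : ℤ, ⨆ _ : p ≤ j, X.G j

/-- `{x ∈ F_pC : dx ∈ F_{p+r}C}`. -/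
def zmod (X : FilteredCx R C) (r : ℕ) (p : ℤ) : Submodule R C :=
  X.F p ⊓ Submodule.comap X.d (X.F (p + r))

/-- `F_{p+1}C + d(F_{p−r+1}C)`. -/
def bmod (X : FilteredCx R C) (r : ℕ) (p : ℤ) : Submodule R C :=
  X.F (p + 1) ⊔ Submodule.map X.d (X.F (p - r + 1))

/-- The spectral sequence page
`E^r_p(C) = {x ∈ F_pC : dx ∈ F_{p+r}C} / (F_{p+1}C + d(F_{p−r+1}C))`. -/
abbrev Epage (X : FilteredCx R C) (r : ℕ) (p : ℤ) : Type _ :=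
  ↥(X.zmod r p) ⧸ Submodule.comap (X.zmod r p).subtype (X.bmod r p)

/-- The class `[x]^r_p ∈ E^r_p(C)` of an element `x ∈ F_pC` with `dx ∈ F_{p+r}C`. -/
def eClass (X : FilteredCx R C) (r : ℕ) (p : ℤ) (x : C) (hx : x ∈ X.zmod r p) :
    X.Epage r p :=
  Submodule.Quotient.mk ⟨x, hx⟩

/-- The homology `H_*(C) = Ker d / Im d`. -/
abbrev Hmod (X : FilteredCx R C) : Type _ :=
  ↥(LinearMap.ker X.d) ⧸
    Submodule.comap (LinearMap.ker X.d).subtype (LinearMap.range X.d)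

/-- The induced filtration `F_pH_*(C) = {[x] ∈ H_*(C) : dx = 0, x ∈ F_pC}`. -/
def FH (X : FilteredCx R C) (p : ℤ) : Submodule R X.Hmod :=
  Submodule.map
    (Submodule.comap (LinearMap.ker X.d).subtype (LinearMap.range X.d)).mkQ
    (Submodule.comap (LinearMap.ker X.d).subtype (X.F p))

/-- The associated graded piece `G_pH_*(C) = F_pH_*(C)/F_{p+1}H_*(C)`. -/
abbrev GH (X : FilteredCx R C) (p : ℤ) : Type _ :=
  ↥(X.FH p) ⧸ Submodule.comap (X.FH p).subtype (X.FH (p + 1))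

end FilteredCx

namespace FilteredCx

variable {R C : Type*} [CommRing R] [AddCommGroup C] [Module R C]

lemma F_anti (X : FilteredCx R C) {p q : ℤ} (h : p ≤ q) : X.F q ≤ X.F p := by
  unfold F
  refine iSup_le fun j => iSup_le fun hj => ?_
  exact le_iSup_of_le j (le_iSup_of_le (h.trans hj) le_rfl)

lemma d_mem_F (X : FilteredCx R C) {p : ℤ} {x : C} (hx : x ∈ X.F p) : X.d x ∈ X.F p := by
  have h : X.F p ≤ (X.F p).comap X.d := by
    conv_lhs => unfold F
    refine iSup_le fun j => iSup_le fun hj => ?_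
    rw [← Submodule.map_le_iff_le_comap]
    exact (X.hdG j).trans (X.F_anti hj)
  exact h hx

lemma d_d (X : FilteredCx R C) (x : C) : X.d (X.d x) = 0 :=
  LinearMap.congr_fun X.dd x

lemma mem_zmod (X : FilteredCx R C) {r : ℕ} {p : ℤ} {x : C} :
    x ∈ X.zmod r p ↔ x ∈ X.F p ∧ X.d x ∈ X.F (p + r) := Iff.rfl

lemma mem_bmod (X : FilteredCx R C) {r : ℕ} {p : ℤ} {x : C} :
    x ∈ X.bmod r p ↔ ∃ f ∈ X.F (p + 1), ∃ y ∈ X.F (p - r + 1), f + X.d y = x := by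
  simp [bmod, Submodule.mem_sup]

lemma eClass_eq_iff (X : FilteredCx R C) {r : ℕ} {p : ℤ} {x y : C} (hx : x ∈ X.zmod r p)
    (hy : y ∈ X.zmod r p) :
    X.eClass r p x hx = X.eClass r p y hy ↔ x - y ∈ X.bmod r p := by
  unfold eClass
  rw [Submodule.Quotient.eq]
  rfl

lemma eClass_eq_zero_iff (X : FilteredCx R C) {r : ℕ} {p : ℤ} {x : C} (hx : x ∈ X.zmod r p) :
    X.eClass r p x hx = 0 ↔ x ∈ X.bmod r p := by
  unfold eClass
  rw [Submodule.Quotient.mk_eq_zero]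
  rfl

lemma exists_eClass (X : FilteredCx R C) {r : ℕ} {p : ℤ} (e : X.Epage r p) :
    ∃ x hx, X.eClass r p x hx = e := by
  obtain ⟨⟨x, hx⟩, rfl⟩ := Submodule.Quotient.mk_surjective _ e
  exact ⟨x, hx, rfl⟩

lemma d_mem_out (X : FilteredCx R C) {r : ℕ} {p : ℤ} {x : C} (hx : x ∈ X.zmod r p) :
    X.d x ∈ X.zmod r (p + r) :=
  ⟨hx.2, by simp [d_d]⟩

lemma d_mem_in (X : FilteredCx R C) {r : ℕ} {p : ℤ} {x : C} (hx : x ∈ X.zmod r (p - r)) :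
    X.d x ∈ X.zmod r p :=
  ⟨by simpa using hx.2, by simp [d_d]⟩

section
variable (X : FilteredCx R C) (r : ℕ) (p : ℤ)

lemma range_le_ker
    (dOut : X.Epage r p →ₗ[R] X.Epage r (p + r))
    (hdOut : ∀ (x : C) (hx : x ∈ X.zmod r p) (hdx : X.d x ∈ X.zmod r (p + r)),
      dOut (X.eClass r p x hx) = X.eClass r (p + r) (X.d x) hdx)
    (dIn : X.Epage r (p - r) →ₗ[R] X.Epage r p)
    (hdIn : ∀ (x : C) (hx : x ∈ X.zmod r (p - r)) (hdx : X.d x ∈ X.zmod r p),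
      dIn (X.eClass r (p - r) x hx) = X.eClass r p (X.d x) hdx)
    : LinearMap.range dIn ≤ LinearMap.ker dOut := by
  rintro _ ⟨e, rfl⟩
  obtain ⟨x, hx, rfl⟩ := X.exists_eClass e
  rw [LinearMap.mem_ker, hdIn x hx (X.d_mem_in hx),
    hdOut _ _ (X.d_mem_out (X.d_mem_in hx)), eClass_eq_zero_iff, d_d]
  exact zero_mem _

lemma zmod_succ_le : X.zmod (r + 1) p ≤ X.zmod r p := fun _ hx =>
  ⟨hx.1, X.F_anti (by push_cast; omega) hx.2⟩

lemma eClass_mem_ker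
    (dOut : X.Epage r p →ₗ[R] X.Epage r (p + r))
    (hdOut : ∀ (x : C) (hx : x ∈ X.zmod r p) (hdx : X.d x ∈ X.zmod r (p + r)),
      dOut (X.eClass r p x hx) = X.eClass r (p + r) (X.d x) hdx)
    {x : C} (hx : x ∈ X.zmod (r + 1) p) :
    X.eClass r p x (X.zmod_succ_le r p hx) ∈ LinearMap.ker dOut := by
  rw [LinearMap.mem_ker, hdOut _ _ (X.d_mem_out (X.zmod_succ_le r p hx)), eClass_eq_zero_iff]
  refine (le_sup_left : _ ≤ X.bmod r (p + r)) ?_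
  have := hx.2
  exact X.F_anti (by push_cast; omega) this

/-- `E^{r+1} ≅ H(E^r)`. -/
lemma exists_equiv
    (dOut : X.Epage r p →ₗ[R] X.Epage r (p + r))
    (hdOut : ∀ (x : C) (hx : x ∈ X.zmod r p) (hdx : X.d x ∈ X.zmod r (p + r)),
      dOut (X.eClass r p x hx) = X.eClass r (p + r) (X.d x) hdx)
    (dIn : X.Epage r (p - r) →ₗ[R] X.Epage r p)
    (hdIn : ∀ (x : C) (hx : x ∈ X.zmod r (p - r)) (hdx : X.d x ∈ X.zmod r p),
      dIn (X.eClass r (p - r) x hx) = X.eClass r p (X.d x) hdx)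
    : Nonempty (X.Epage (r + 1) p ≃ₗ[R] (↥(LinearMap.ker dOut) ⧸
          Submodule.comap (LinearMap.ker dOut).subtype (LinearMap.range dIn))) := by
  let N := Submodule.comap (LinearMap.ker dOut).subtype (LinearMap.range dIn)
  let g : ↥(X.zmod (r + 1) p) →ₗ[R] ↥(LinearMap.ker dOut) :=
    LinearMap.codRestrict (LinearMap.ker dOut)
      ((Submodule.mkQ _ : _ →ₗ[R] X.Epage r p) ∘ₗ Submodule.inclusion (X.zmod_succ_le r p))
      (fun x => X.eClass_mem_ker r p dOut hdOut x.2)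
  have hg : ∀ x, (g x : X.Epage r p) = X.eClass r p x.1 (X.zmod_succ_le r p x.2) := fun x => rfl
  let f := N.mkQ ∘ₗ g
  have hsurj : Function.Surjective f := by
    intro e
    obtain ⟨⟨e, he⟩, rfl⟩ := Submodule.Quotient.mk_surjective _ e
    obtain ⟨x, hx, rfl⟩ := X.exists_eClass e
    have he' := he
    rw [LinearMap.mem_ker, hdOut _ _ (X.d_mem_out hx), eClass_eq_zero_iff, mem_bmod] at he'
    obtain ⟨u, hu, y, hy, huy⟩ := he'
    have hy' : y ∈ X.F (p + 1) := by simpa using hy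
    have hmem : x - y ∈ X.zmod (r + 1) p := by
      refine ⟨sub_mem hx.1 (X.F_anti (by omega) hy'), ?_⟩
      rw [SetLike.mem_coe, Submodule.mem_comap, map_sub, ← huy, add_sub_cancel_right]
      exact X.F_anti (by push_cast; omega) hu
    refine ⟨⟨x - y, hmem⟩, ?_⟩
    change N.mkQ _ = N.mkQ _
    congr 1
    apply Subtype.ext
    rw [hg]
    change X.eClass r p (x - y) _ = X.eClass r p x hx
    rw [eClass_eq_iff]
    refine (le_sup_left : _ ≤ X.bmod r p) ?_
    have : x - y - x = -y := by abel
    rw [this]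
    exact neg_mem hy'
  have hker : LinearMap.ker f =
      Submodule.comap (X.zmod (r + 1) p).subtype (X.bmod (r + 1) p) := by
    ext ⟨x, hx⟩
    have h1 : (⟨x, hx⟩ : X.zmod (r + 1) p) ∈ LinearMap.ker f ↔
        X.eClass r p x (X.zmod_succ_le r p hx) ∈ LinearMap.range dIn := by
      rw [LinearMap.mem_ker]
      change N.mkQ _ = 0 ↔ _
      rw [Submodule.mkQ_apply, Submodule.Quotient.mk_eq_zero]
      rfl
    rw [h1]
    change _ ↔ x ∈ X.bmod (r + 1) p
    rw [mem_bmod]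
    constructor
    · rintro ⟨e, he⟩
      obtain ⟨z, hz, rfl⟩ := X.exists_eClass e
      rw [hdIn _ _ (X.d_mem_in hz), eClass_eq_iff, mem_bmod] at he
      obtain ⟨u, hu, y, hy, huy⟩ := he
      refine ⟨-u, neg_mem hu, z - y, sub_mem (X.F_anti (by push_cast; omega) hz.1)
        (X.F_anti (by push_cast; omega) hy), ?_⟩
      have hxe : x = X.d z - (u + X.d y) := by rw [huy]; abel
      rw [map_sub, hxe]
      abel
    · rintro ⟨u, hu, y, hy, huy⟩
      have hy' : y ∈ X.F (p - r) := X.F_anti (by push_cast; omega) hy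
      have hyz : y ∈ X.zmod r (p - r) := by
        refine ⟨hy', ?_⟩
        rw [SetLike.mem_coe, Submodule.mem_comap, sub_add_cancel, eq_sub_of_add_eq' huy]
        exact sub_mem hx.1 (X.F_anti (by omega) hu)
      refine ⟨X.eClass r (p - r) y hyz, ?_⟩
      rw [hdIn _ _ (X.d_mem_in hyz), eClass_eq_iff, ← huy]
      refine (le_sup_left : _ ≤ X.bmod r p) ?_
      have : X.d y - (u + X.d y) = -u := by abel
      rw [this]
      exact neg_mem hu
  exact ⟨(Submodule.quotEquivOfEq _ _ hker.symm).trans (f.quotKerEquivOfSurjective hsurj)⟩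

end

end FilteredCx

/-- The purely algebraic part. -/
lemma torsion_aux {R E H : Type*} [CommRing R] [IsDomain R] [IsPrincipalIdealRing R]
    [AddCommGroup E] [Module R E] [Module.Finite R E] [AddCommGroup H] [Module R H]
    (K I : Submodule R E) (hIK : I ≤ K)
    (e : H ≃ₗ[R] (K ⧸ Submodule.comap K.subtype I))
    (hrank : Module.finrank R E = Module.finrank R H) :
    I ≤ Submodule.torsion R E ∧
    Submodule.torsion R (K ⧸ Submodule.comap K.subtype I) =
      Submodule.map (Submodule.comap K.subtype I).mkQ (Submodule.torsion R K) ∧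
    (Finite (Submodule.torsion R E) →
      Nat.card (Submodule.torsion R H) ≤ Nat.card (Submodule.torsion R E)) := by
  have h1 : I ≤ Submodule.torsion R E := by
    have h := Submodule.finrank_quotient_add_finrank (Submodule.comap K.subtype I)
    have h2 := Submodule.finrank_le K
    rw [hrank, e.finrank_eq] at h2
    have h0 : Module.finrank R (Submodule.comap K.subtype I) = 0 := by omega
    rw [Module.finrank_eq_zero_iff] at h0
    intro x hx
    obtain ⟨a, ha, hax⟩ := h0 ⟨⟨x, hIK hx⟩, hx⟩
    rw [Submodule.mem_torsion_iff]
    refine ⟨⟨a, mem_nonZeroDivisors_of_ne_zero ha⟩, ?_⟩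
    exact congrArg (fun z : Submodule.comap K.subtype I => ((z : K) : E)) hax
  have h2 : Submodule.torsion R (K ⧸ Submodule.comap K.subtype I) =
      Submodule.map (Submodule.comap K.subtype I).mkQ (Submodule.torsion R K) := by
    apply le_antisymm
    · intro q hq
      obtain ⟨x, rfl⟩ := Submodule.mkQ_surjective _ q
      rw [Submodule.mem_torsion_iff] at hq
      obtain ⟨a, ha⟩ := hq
      have ha' : (a : R) • (x : E) ∈ I := by
        have : Submodule.mkQ (Submodule.comap K.subtype I) ((a : R) • x) = 0 := by
          rw [map_smul]; exact ha
        rw [Submodule.mkQ_apply, Submodule.Quotient.mk_eq_zero] at this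
        exact this
      have h3 := h1 ha'
      rw [Submodule.mem_torsion_iff] at h3
      obtain ⟨b, hb⟩ := h3
      refine Submodule.mem_map_of_mem ?_
      rw [Submodule.mem_torsion_iff]
      refine ⟨b * a, Subtype.ext ?_⟩
      rw [mul_smul]
      exact hb
    · rintro _ ⟨x, hx, rfl⟩
      obtain ⟨a, ha⟩ := (Submodule.mem_torsion_iff _).mp hx
      rw [Submodule.mem_torsion_iff]
      refine ⟨a, ?_⟩
      have := congrArg (Submodule.mkQ (Submodule.comap K.subtype I)) ha
      rw [map_zero] at this
      exact this
  refine ⟨h1, h2, fun hfin => ?_⟩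
  let i : Submodule.torsion R K → Submodule.torsion R E := fun x =>
    ⟨x.1.1, by
      obtain ⟨a, ha⟩ := (Submodule.mem_torsion_iff _).mp x.2
      exact (Submodule.mem_torsion_iff _).mpr ⟨a, congrArg Subtype.val ha⟩⟩
  have hi : Function.Injective i := fun x y hxy => by
    have := congrArg Subtype.val hxy
    exact Subtype.ext (Subtype.ext this)
  let j : Submodule.torsion R H → Submodule.torsion R (K ⧸ Submodule.comap K.subtype I) :=
    fun x => ⟨e x.1, by
      obtain ⟨a, ha⟩ := (Submodule.mem_torsion_iff _).mp x.2
      refine (Submodule.mem_torsion_iff _).mpr ⟨a, ?_⟩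
      have := congrArg e ha
      rw [map_zero] at this
      rw [← this]
      exact (e.map_smul (a : R) x.1).symm⟩
  have hj : Function.Injective j := fun x y hxy => by
    have := congrArg Subtype.val hxy
    exact Subtype.ext (e.injective this)
  let s : Submodule.torsion R K → Submodule.torsion R (K ⧸ Submodule.comap K.subtype I) :=
    fun x => ⟨(Submodule.comap K.subtype I).mkQ x.1, by
      rw [h2]; exact Submodule.mem_map_of_mem x.2⟩
  have hs : Function.Surjective s := by
    rintro ⟨q, hq⟩
    have hq' := hq
    rw [h2] at hq'
    obtain ⟨x, hx, rfl⟩ := hq'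
    exact ⟨⟨x, hx⟩, rfl⟩
  have : Finite (Submodule.torsion R K) := Finite.of_injective i hi
  have : Finite (Submodule.torsion R (K ⧸ Submodule.comap K.subtype I)) :=
    Finite.of_surjective s hs
  exact (Nat.card_le_card_of_injective j hj).trans
    ((Nat.card_le_card_of_surjective s hs).trans (Nat.card_le_card_of_injective i hi))

/-- If `rank_R E^r_p(C) = rank_R E^{r+1}_p(C)`, then
`Im d^r_{p−r} ⊆ Tor E^r_p(C)` and `Tor H_*(E^r_p(C)) = Tor(Ker d^r_p)/Im d^r_{p−r}`;
in particular, if `Tor E^r_p(C)` is finite then `|Tor E^r_p(C)| ≥ |Tor E^{r+1}_p(C)|`. -/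
theorem stmt10 {R C : Type*} [CommRing R] [IsDomain R] [IsPrincipalIdealRing R]
    [AddCommGroup C] [Module R C] [Module.Finite R C] [Module.Free R C]
    (X : FilteredCx R C) (r : ℕ) (p : ℤ)
    (dOut : X.Epage r p →ₗ[R] X.Epage r (p + r))
    (hdOut : ∀ (x : C) (hx : x ∈ X.zmod r p) (hdx : X.d x ∈ X.zmod r (p + r)),
      dOut (X.eClass r p x hx) = X.eClass r (p + r) (X.d x) hdx)
    (dIn : X.Epage r (p - r) →ₗ[R] X.Epage r p)
    (hdIn : ∀ (x : C) (hx : x ∈ X.zmod r (p - r)) (hdx : X.d x ∈ X.zmod r p),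
      dIn (X.eClass r (p - r) x hx) = X.eClass r p (X.d x) hdx)
    (hrank : Module.rank R (X.Epage r p) = Module.rank R (X.Epage (r + 1) p)) :
    LinearMap.range dIn ≤ Submodule.torsion R (X.Epage r p) ∧
    Submodule.torsion R
        (↥(LinearMap.ker dOut) ⧸
          Submodule.comap (LinearMap.ker dOut).subtype (LinearMap.range dIn)) =
      Submodule.map
        (Submodule.comap (LinearMap.ker dOut).subtype (LinearMap.range dIn)).mkQ
        (Submodule.torsion R ↥(LinearMap.ker dOut)) ∧
    (Finite (Submodule.torsion R (X.Epage r p)) →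
      Nat.card (Submodule.torsion R (X.Epage (r + 1) p)) ≤
        Nat.card (Submodule.torsion R (X.Epage r p))) := by
  obtain ⟨e⟩ := X.exists_equiv r p dOut hdOut dIn hdIn
  exact torsion_aux (LinearMap.ker dOut) (LinearMap.range dIn)
    (X.range_le_ker r p dOut hdOut dIn hdIn) e (congrArg Cardinal.toNat hrank)
end

section
/- Let R be a PID and (C, d) a filtered complex with spectral sequence {E^r(C), d^r}. Suppose Tor E^r_p(C) is finite. If rank_R E^r_p(C) = rank_R E^{r+1}_p(C) and |Tor E^r_p(C)| = |Tor E^{r+1}_p(C)|, then the differential d^r_{p−r} : E^r_{p−r}(C) → E^r_p(C) is zero. -/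
open LinearMap Submodule

theorem stmt11_aux {R E E' : Type*} [CommRing R] [IsDomain R] [AddCommGroup E] [Module R E]
    [Module.Finite R E] [AddCommGroup E'] [Module R E'] (W : Submodule R E)
    (g : W →ₗ[R] E') (hg : Function.Surjective g)
    (hfin : Finite (Submodule.torsion R E))
    (hrank : Module.finrank R E ≤ Module.finrank R E') (hW : Module.rank R W < Cardinal.aleph0)
    (hcard : Nat.card (Submodule.torsion R E) ≤ Nat.card (Submodule.torsion R E')) :
    ∀ w : W, g w = 0 → w = 0 := by
  have hsum := rank_quotient_add_rank_of_isDomain (LinearMap.ker g)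
  have e := (g.quotKerEquivOfSurjective hg)
  have hk0 : Module.rank R (LinearMap.ker g) < Cardinal.aleph0 :=
    lt_of_le_of_lt (Submodule.rank_le _) hW
  have hq0 : Module.rank R (W ⧸ LinearMap.ker g) < Cardinal.aleph0 :=
    lt_of_le_of_lt (le_of_le_of_eq (self_le_add_right _ _) hsum) hW
  have h1 : Module.finrank R (W ⧸ LinearMap.ker g) + Module.finrank R (LinearMap.ker g)
      = Module.finrank R W := by
    unfold Module.finrank
    rw [← hsum, Cardinal.toNat_add hq0 hk0]
  have h2 : Module.finrank R W ≤ Module.finrank R E := Submodule.finrank_le W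
  have h3 := e.finrank_eq
  have h4 : Module.finrank R (LinearMap.ker g) = 0 := by omega
  have h5 : Module.rank R (LinearMap.ker g) = 0 := by
    rcases (Cardinal.toNat_eq_zero).1 h4 with h | h
    · exact h
    · exact absurd hk0 (not_lt.2 h)
  rw [rank_eq_zero_iff] at h5
  have hker : ∀ w : W, g w = 0 → w ∈ Submodule.torsion R W := by
    intro w hw
    obtain ⟨a, ha, h⟩ := h5 ⟨w, hw⟩
    rw [Submodule.mem_torsion_iff]
    exact ⟨⟨a, mem_nonZeroDivisors_of_ne_zero ha⟩, congrArg Subtype.val h⟩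
  let i : Submodule.torsion R W → Submodule.torsion R E := fun w => ⟨w.1.1, by
    obtain ⟨a, h⟩ := (Submodule.mem_torsion_iff _).1 w.2
    exact (Submodule.mem_torsion_iff _).2 ⟨a, congrArg Subtype.val h⟩⟩
  have hi : Function.Injective i := fun x y h =>
    Subtype.ext (Subtype.ext (congrArg (fun z => z.1) h))
  have hfW : Finite (Submodule.torsion R W) := Finite.of_injective i hi
  have hc := Nat.card_le_card_of_injective i hi
  let j : Submodule.torsion R W → Submodule.torsion R E' := fun w => ⟨g w.1, by
    obtain ⟨a, h⟩ := (Submodule.mem_torsion_iff _).1 w.2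
    refine (Submodule.mem_torsion_iff _).2 ⟨a, ?_⟩
    have := congrArg g h
    rwa [map_zero, Submonoid.smul_def, map_smul] at this⟩
  have hj : Function.Surjective j := by
    rintro ⟨y, hy⟩
    obtain ⟨w, rfl⟩ := hg y
    obtain ⟨a, h⟩ := (Submodule.mem_torsion_iff _).1 hy
    rw [Submonoid.smul_def, ← map_smul] at h
    obtain ⟨b, hb⟩ := (Submodule.mem_torsion_iff _).1 (hker _ h)
    refine ⟨⟨w, (Submodule.mem_torsion_iff _).2 ⟨b * a, ?_⟩⟩, rfl⟩
    rw [mul_smul]; exact hb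
  have hfE' : Finite (Submodule.torsion R E') := Finite.of_surjective j hj
  have hbij : Function.Bijective j :=
    (Nat.bijective_iff_surjective_and_card j).2 ⟨hj, le_antisymm (hc.trans hcard)
      (Nat.card_le_card_of_surjective j hj)⟩
  intro w hw
  have : (⟨w, hker w hw⟩ : Submodule.torsion R W) = 0 :=
    hbij.1 (Subtype.ext (by simp [j, hw]))
  exact congrArg Subtype.val this

theorem stmt11_aux2 {R Z E E' : Type*} [CommRing R] [IsDomain R] [IsNoetherianRing R]
    [AddCommGroup Z] [Module R Z] [AddCommGroup E] [Module R E]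
    [Module.Finite R E] [AddCommGroup E'] [Module R E'] 
    (π : Z →ₗ[R] E) (q : Z →ₗ[R] E') (hq : Function.Surjective q)
    (hπq : LinearMap.ker π ≤ LinearMap.ker q)
    (hfin : Finite (Submodule.torsion R E))
    (hrank : Module.finrank R E ≤ Module.finrank R E')
    (hcard : Nat.card (Submodule.torsion R E) ≤ Nat.card (Submodule.torsion R E')) :
    ∀ z : Z, q z = 0 → π z = 0 := by
  let g : LinearMap.range π →ₗ[R] E' :=
    ((LinearMap.ker π).liftQ q hπq) ∘ₗ π.quotKerEquivRange.symm.toLinearMap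
  have hgπ : ∀ z, g ⟨π z, LinearMap.mem_range_self π z⟩ = q z := by
    intro z
    have := π.quotKerEquivRange_symm_apply_image z (LinearMap.mem_range_self π z)
    simp only [g, LinearMap.comp_apply, LinearEquiv.coe_coe, this]
    exact Submodule.liftQ_apply _ _ _
  have hg : Function.Surjective g := by
    intro y
    obtain ⟨z, rfl⟩ := hq y
    exact ⟨_, hgπ z⟩
  intro z hz
  have key := stmt11_aux (LinearMap.range π) g hg hfin hrank (Module.rank_lt_aleph0 R _) hcard
    ⟨π z, LinearMap.mem_range_self π z⟩ ((hgπ z).trans hz)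
  exact congrArg Subtype.val key

theorem FilteredCx.F_anti_s11 {R C : Type*} [CommRing R] [AddCommGroup C] [Module R C]
    (X : FilteredCx R C) {a b : ℤ} (h : a ≤ b) : X.F b ≤ X.F a := by
  unfold FilteredCx.F
  exact iSup_mono fun j => iSup_mono' fun hj => ⟨h.trans hj, le_rfl⟩

theorem FilteredCx.zmod_succ_le_s11 {R C : Type*} [CommRing R] [AddCommGroup C] [Module R C]
    (X : FilteredCx R C) (r : ℕ) (p : ℤ) : X.zmod (r + 1) p ≤ X.zmod r p := by
  have h : p + (r : ℤ) ≤ p + ((r + 1 : ℕ) : ℤ) := by push_cast; omega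
  exact inf_le_inf le_rfl (Submodule.comap_mono (X.F_anti_s11 h))

theorem FilteredCx.bmod_le_succ {R C : Type*} [CommRing R] [AddCommGroup C] [Module R C]
    (X : FilteredCx R C) (r : ℕ) (p : ℤ) : X.bmod r p ≤ X.bmod (r + 1) p := by
  have h : p - ((r + 1 : ℕ) : ℤ) + 1 ≤ p - (r : ℤ) + 1 := by push_cast; omega
  exact sup_le_sup le_rfl (Submodule.map_mono (X.F_anti_s11 h))

theorem FilteredCx.d_mem_zmod {R C : Type*} [CommRing R] [AddCommGroup C] [Module R C]
    (X : FilteredCx R C) (r : ℕ) (p : ℤ) (x : C) (hx : x ∈ X.zmod r (p - r)) :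
    X.d x ∈ X.zmod (r + 1) p := by
  have h0 : X.d (X.d x) = 0 := LinearMap.congr_fun X.dd x
  unfold FilteredCx.zmod at hx ⊢
  rw [Submodule.mem_inf, Submodule.mem_comap] at hx ⊢
  rw [sub_add_cancel] at hx
  rw [h0]
  exact ⟨hx.2, zero_mem _⟩

theorem FilteredCx.d_mem_bmod {R C : Type*} [CommRing R] [AddCommGroup C] [Module R C]
    (X : FilteredCx R C) (r : ℕ) (p : ℤ) (x : C) (hx : x ∈ X.zmod r (p - r)) :
    X.d x ∈ X.bmod (r + 1) p := by
  have h : p - ((r + 1 : ℕ) : ℤ) + 1 ≤ p - (r : ℤ) := by push_cast; omega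
  exact Submodule.mem_sup_right (Submodule.mem_map_of_mem (X.F_anti_s11 h (Submodule.mem_inf.1 hx).1))

theorem FilteredCx.eClass_eq_zero_iff_s11 {R C : Type*} [CommRing R] [AddCommGroup C] [Module R C]
    (X : FilteredCx R C) (r : ℕ) (p : ℤ) (x : C) (hx : x ∈ X.zmod r p) :
    X.eClass r p x hx = 0 ↔ x ∈ X.bmod r p := by
  unfold FilteredCx.eClass
  rw [Submodule.Quotient.mk_eq_zero, Submodule.mem_comap, Submodule.subtype_apply]

/-- The class map as a linear map. -/
def FilteredCx.eMap {R C : Type*} [CommRing R] [AddCommGroup C] [Module R C]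
    (X : FilteredCx R C) (r : ℕ) (p : ℤ) : X.zmod r p →ₗ[R] X.Epage r p :=
  (Submodule.comap (X.zmod r p).subtype (X.bmod r p)).mkQ

theorem FilteredCx.eMap_apply {R C : Type*} [CommRing R] [AddCommGroup C] [Module R C]
    (X : FilteredCx R C) (r : ℕ) (p : ℤ) (z : X.zmod r p) :
    X.eMap r p z = X.eClass r p z.1 z.2 := rfl

theorem FilteredCx.eMap_surjective {R C : Type*} [CommRing R] [AddCommGroup C] [Module R C]
    (X : FilteredCx R C) (r : ℕ) (p : ℤ) : Function.Surjective (X.eMap r p) :=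
  Submodule.mkQ_surjective _

theorem FilteredCx.ker_le {R C : Type*} [CommRing R] [AddCommGroup C] [Module R C]
    (X : FilteredCx R C) (r : ℕ) (p : ℤ) :
    LinearMap.ker (X.eMap r p ∘ₗ Submodule.inclusion (X.zmod_succ_le_s11 r p)) ≤
      LinearMap.ker (X.eMap (r + 1) p) := by
  intro z hz
  have h1 : X.eClass r p z.1 (X.zmod_succ_le_s11 r p z.2) = 0 := hz
  have h2 := X.bmod_le_succ r p ((X.eClass_eq_zero_iff_s11 r p _ _).1 h1)
  exact (X.eClass_eq_zero_iff_s11 (r + 1) p z.1 z.2).2 h2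

/-- If `Tor E^r_p(C)` is finite, `rank_R E^r_p(C) = rank_R E^{r+1}_p(C)`
and `|Tor E^r_p(C)| = |Tor E^{r+1}_p(C)|`, then `d^r_{p−r} = 0`. -/
theorem stmt11 {R C : Type*} [CommRing R] [IsDomain R] [IsPrincipalIdealRing R]
    [AddCommGroup C] [Module R C] [Module.Finite R C] [Module.Free R C]
    (X : FilteredCx R C) (r : ℕ) (p : ℤ)
    (dOut : X.Epage r p →ₗ[R] X.Epage r (p + r))
    (hdOut : ∀ (x : C) (hx : x ∈ X.zmod r p) (hdx : X.d x ∈ X.zmod r (p + r)),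
      dOut (X.eClass r p x hx) = X.eClass r (p + r) (X.d x) hdx)
    (dIn : X.Epage r (p - r) →ₗ[R] X.Epage r p)
    (hdIn : ∀ (x : C) (hx : x ∈ X.zmod r (p - r)) (hdx : X.d x ∈ X.zmod r p),
      dIn (X.eClass r (p - r) x hx) = X.eClass r p (X.d x) hdx)
    (hfin : Finite (Submodule.torsion R (X.Epage r p)))
    (hrank : Module.rank R (X.Epage r p) = Module.rank R (X.Epage (r + 1) p))
    (hcard : Nat.card (Submodule.torsion R (X.Epage r p)) =
      Nat.card (Submodule.torsion R (X.Epage (r + 1) p))) :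
    dIn = 0 := by
  have hZ := X.zmod_succ_le_s11 r p
  have hfr : Module.finrank R (X.Epage r p) = Module.finrank R (X.Epage (r + 1) p) := by
    rw [Module.finrank, Module.finrank, hrank]
  have key := stmt11_aux2 (X.eMap r p ∘ₗ Submodule.inclusion hZ) (X.eMap (r + 1) p)
    (X.eMap_surjective (r + 1) p) (X.ker_le r p) hfin
    hfr.le hcard.le
  refine LinearMap.ext fun y => ?_
  obtain ⟨⟨x, hx⟩, rfl⟩ := X.eMap_surjective r (p - r) y
  have hdx := X.d_mem_zmod r p x hx
  have h := key ⟨X.d x, hdx⟩ (by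
    rw [X.eMap_apply, X.eClass_eq_zero_iff_s11]
    exact X.d_mem_bmod r p x hx)
  rw [LinearMap.comp_apply, X.eMap_apply] at h
  rw [X.eMap_apply, LinearMap.zero_apply]
  exact (hdIn x hx (hZ hdx)).trans h
end
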